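/- Let Ω be a finite set and P an ℓ-step probability distribution on Ω^ℓ with equal marginals π (with support all of Ω). Let f^{(1)},…,f^{(ℓ)} : Ωⁿ → [0,1], let i ∈ [n], j* ∈ [ℓ], and let τ, ρ satisfy 0 ≤ τ ≤ Inf_i(f^{(j*)}(X^{(j*)})) and ρ(P) ≤ ρ ≤ 1. Then there exist values x̄^{∖j*} = (x^{(1)},…,x^{(j*−1)},x^{(j*+1)},…,x^{(ℓ)}) ∈ Ω^{ℓ−1} and y, z ∈ Ω such that, defining g^{(j)} := R[i,x^{(j)}]f^{(j)} for j ≠ j* and g^{(j*)} := M[i,y,z]f^{(j*)}, one has: (i) Σ_{j=1}^ℓ E[g^{(j)}(X^{(j)})] ≥ Σ_{j=1}^ℓ E[f^{(j)}(X^{(j)})] + τ(1−ρ²)/2; and (ii) E[∏_{j=1}^ℓ f^{(j)}(X^{(j)})] ≥ (τ(1−ρ²)/(2ℓ|Ω|^{ℓ+1})) · E[∏_{j=1}^ℓ g^{(j)}(X^{(j)})]. -/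

import Mathlib

namespace SameSetHitting

/-- `P` is a probability distribution on a finite type. -/
def IsDist {α : Type} [Fintype α] (P : α → ℝ) : Prop :=
  (∀ x, 0 ≤ P x) ∧ ∑ x, P x = 1

open Classical in
/-- The `j`-th marginal of an `ℓ`-step distribution `P`. -/
noncomputable def marginal {Ω : Type} [Fintype Ω] {ℓ : ℕ}
    (P : (Fin ℓ → Ω) → ℝ) (j : Fin ℓ) (a : Ω) : ℝ :=
  ∑ x : Fin ℓ → Ω, if x j = a then P x else 0

/-- All `ℓ` marginals of `P` are equal to `π`. -/
def HasMarginals {Ω : Type} [Fintype Ω] {ℓ : ℕ}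
    (P : (Fin ℓ → Ω) → ℝ) (π : Ω → ℝ) : Prop :=
  ∀ j a, marginal P j a = π a

/-- The expectation `E[f(X)]` where `X` has the product law `πⁿ`. -/
noncomputable def exps {Ω : Type} [Fintype Ω] {n : ℕ}
    (π : Ω → ℝ) (f : (Fin n → Ω) → ℝ) : ℝ :=
  ∑ v : Fin n → Ω, (∏ i, π (v i)) * f v

/-- `E[∏_{j} f_j(X^{(j)})]` where the tuples `(X_i^{(1)}, …, X_i^{(ℓ)})`,
`i = 1, …, n`, are i.i.d. with law `P` and `X^{(j)} = (X_1^{(j)}, …, X_n^{(j)})`. -/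
noncomputable def prodExp {Ω : Type} [Fintype Ω] {ℓ n : ℕ}
    (P : (Fin ℓ → Ω) → ℝ) (f : Fin ℓ → ((Fin n → Ω) → ℝ)) : ℝ :=
  ∑ x : Fin ℓ → Fin n → Ω, (∏ i, P (fun j => x j i)) * ∏ j, f j (x j)

/-- Expectation under the single-coordinate multi-step distribution `P`. -/
noncomputable def expP {Ω : Type} [Fintype Ω] {ℓ : ℕ}
    (P : (Fin ℓ → Ω) → ℝ) (f : (Fin ℓ → Ω) → ℝ) : ℝ :=
  ∑ x, P x * f x

/-- Covariance under `P`. -/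
noncomputable def covP {Ω : Type} [Fintype Ω] {ℓ : ℕ}
    (P : (Fin ℓ → Ω) → ℝ) (f g : (Fin ℓ → Ω) → ℝ) : ℝ :=
  expP P (fun x => f x * g x) - expP P f * expP P g

/-- Variance under `P`. -/
noncomputable def varP {Ω : Type} [Fintype Ω] {ℓ : ℕ}
    (P : (Fin ℓ → Ω) → ℝ) (f : (Fin ℓ → Ω) → ℝ) : ℝ :=
  covP P f f

/-- `f` depends only on the coordinates in `S`. -/
def DependsOn {Ω : Type} {ℓ : ℕ} (f : (Fin ℓ → Ω) → ℝ) (S : Finset (Fin ℓ)) : Prop :=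
  ∀ x y : Fin ℓ → Ω, (∀ j ∈ S, x j = y j) → f x = f y

/-- The correlation `ρ(P, S, T)`. -/
noncomputable def rhoST {Ω : Type} [Fintype Ω] {ℓ : ℕ}
    (P : (Fin ℓ → Ω) → ℝ) (S T : Finset (Fin ℓ)) : ℝ :=
  sSup {r : ℝ | ∃ f g : (Fin ℓ → Ω) → ℝ, DependsOn f S ∧ DependsOn g T ∧
    varP P f = 1 ∧ varP P g = 1 ∧ r = covP P f g}

/-- The correlation `ρ(P) = max_j ρ(P, {j}, [ℓ]∖{j})`. -/
noncomputable def rho {Ω : Type} [Fintype Ω] {ℓ : ℕ} (P : (Fin ℓ → Ω) → ℝ) : ℝ :=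
  ⨆ j : Fin ℓ, rhoST P {j} ({j}ᶜ)

/-- Expectation under the single-step distribution `π`. -/
noncomputable def expPi {Ω : Type} [Fintype Ω] (π : Ω → ℝ) (f : Ω → ℝ) : ℝ :=
  ∑ a, π a * f a

/-- Variance under the single-step distribution `π`. -/
noncomputable def varPi {Ω : Type} [Fintype Ω] (π : Ω → ℝ) (f : Ω → ℝ) : ℝ :=
  expPi π (fun a => (f a - expPi π f) ^ 2)

/-- The influence `Inf_i(f(X))` of coordinate `i`, where `X` has product law `πⁿ`. -/
noncomputable def influence {Ω : Type} [Fintype Ω] {n : ℕ}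
    (π : Ω → ℝ) (i : Fin n) (f : (Fin n → Ω) → ℝ) : ℝ :=
  ∑ v : Fin n → Ω, (∏ k, π (v k)) * varPi π (fun a => f (Function.update v i a))

/-- The function obtained from `f` by applying the restriction `R`
(`none` means unrestricted). -/
def restrict {Ω : Type} {n : ℕ} (R : Fin n → Option Ω)
    (f : (Fin n → Ω) → ℝ) : (Fin n → Ω) → ℝ :=
  fun x => f (fun i => (R i).getD (x i))

/-- The size (number of restricted coordinates) of a restriction. -/
def restSize {Ω : Type} {n : ℕ} (R : Fin n → Option Ω) : ℕ :=
  (Finset.univ.filter (fun i => (R i).isSome = true)).card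

/-- `f` is `ε`-resilient up to size `k` (with respect to the product law `πⁿ`). -/
def Resilient {Ω : Type} [Fintype Ω] {n : ℕ} (π : Ω → ℝ) (ε : ℝ) (k : ℕ)
    (f : (Fin n → Ω) → ℝ) : Prop :=
  ∀ R : Fin n → Option Ω, restSize R ≤ k →
    (1 - ε) * exps π f ≤ exps π (restrict R f) ∧
    exps π (restrict R f) ≤ (1 + ε) * exps π f

/-- The restriction operator `R[i,a]`. -/
def restrOp {Ω : Type} {n : ℕ} (i : Fin n) (a : Ω)
    (f : (Fin n → Ω) → ℝ) : (Fin n → Ω) → ℝ :=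
  fun x => f (Function.update x i a)

/-- The maximum operator `M[i,y,z]`. -/
def maxOp {Ω : Type} {n : ℕ} (i : Fin n) (y z : Ω)
    (f : (Fin n → Ω) → ℝ) : (Fin n → Ω) → ℝ :=
  fun x => max (f (Function.update x i y)) (f (Function.update x i z))

/-- Insert the value `a` at position `j` into `w : Ω^{[ℓ] ∖ {j}}`. -/
def ins {Ω : Type} {ℓ : ℕ} (j : Fin ℓ) (w : {k : Fin ℓ // k ≠ j} → Ω) (a : Ω) :
    Fin ℓ → Ω :=
  fun k => if h : k = j then a else w ⟨k, h⟩

/-- The probability that the coordinates other than `j` equal `w`. -/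
noncomputable def margOff {Ω : Type} [Fintype Ω] {ℓ : ℕ}
    (P : (Fin ℓ → Ω) → ℝ) (j : Fin ℓ) (w : {k : Fin ℓ // k ≠ j} → Ω) : ℝ :=
  ∑ a, P (ins j w a)

open Classical in
/-- The joint law of `(Y, Z)` for a double sample on step `j` from `P`. -/
noncomputable def doubleSample {Ω : Type} [Fintype Ω] {ℓ : ℕ}
    (P : (Fin ℓ → Ω) → ℝ) (j : Fin ℓ) (y z : Ω) : ℝ :=
  ∑ w : {k : Fin ℓ // k ≠ j} → Ω,
    if margOff P j w = 0 then 0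
    else P (ins j w y) * P (ins j w z) / margOff P j w


lemma sum_swap3 {A B C D : Type} [Fintype A] [Fintype B] [Fintype C] [Fintype D]
    (F : A → B → C → D → ℝ) :
    ∑ a, ∑ b, ∑ c, ∑ d, F a b c d = ∑ d, ∑ a, ∑ b, ∑ c, F a b c d := by
  have h1 : ∀ a, ∑ b, ∑ c, ∑ d, F a b c d = ∑ d, ∑ b, ∑ c, F a b c d := by
    intro a
    have h2 : ∀ b, ∑ c, ∑ d, F a b c d = ∑ d, ∑ c, F a b c d := fun b => Finset.sum_comm
    simp only [h2]
    exact Finset.sum_comm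
  simp only [h1]
  exact Finset.sum_comm

/-- Resampling one coordinate of a product law. -/
lemma exps_resample {Ω : Type} [Fintype Ω] {n : ℕ} (π : Ω → ℝ) (hπ : ∑ a, π a = 1)
    (i : Fin n) (F : (Fin n → Ω) → ℝ) :
    exps π F = ∑ a, π a * exps π (restrOp i a F) := by
  have key : ∀ (v : Fin n → Ω) (a : Ω),
      (∏ k, π (v k)) * π a = (∏ k, π (Function.update v i a k)) * π (v i) := by
    intro v a
    rw [← Finset.mul_prod_erase Finset.univ (fun k => π (v k)) (Finset.mem_univ i),
      ← Finset.mul_prod_erase Finset.univ (fun k => π (Function.update v i a k))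
        (Finset.mem_univ i)]
    have : ∏ k ∈ Finset.univ.erase i, π (Function.update v i a k)
        = ∏ k ∈ Finset.univ.erase i, π (v k) := by
      apply Finset.prod_congr rfl
      intro k hk
      rw [Function.update_of_ne (Finset.ne_of_mem_erase hk)]
    rw [this]
    simp only [Function.update_self]
    ring
  let e : ((Fin n → Ω) × Ω) ≃ ((Fin n → Ω) × Ω) :=
    { toFun := fun p => (Function.update p.1 i p.2, p.1 i)
      invFun := fun p => (Function.update p.1 i p.2, p.1 i)
      left_inv := by intro p; simp
      right_inv := by intro p; simp }
  have h1 : ∑ a, π a * exps π (restrOp i a F)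
      = ∑ p : (Fin n → Ω) × Ω, (∏ k, π (p.1 k)) * π p.2 * F (Function.update p.1 i p.2) := by
    rw [Fintype.sum_prod_type_right]
    apply Finset.sum_congr rfl
    intro a _
    unfold exps restrOp
    rw [Finset.mul_sum]
    apply Finset.sum_congr rfl
    intro v _
    ring
  have h2 : exps π F = ∑ p : (Fin n → Ω) × Ω, (∏ k, π (p.1 k)) * π p.2 * F p.1 := by
    rw [Fintype.sum_prod_type]
    unfold exps
    apply Finset.sum_congr rfl
    intro v _
    dsimp only
    rw [← Finset.sum_mul, ← Finset.mul_sum, hπ, mul_one]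
  rw [h1, h2]
  rw [← e.sum_comp]
  apply Finset.sum_congr rfl
  intro p _
  have := key p.1 p.2
  show (∏ k, π (Function.update p.1 i p.2 k)) * π (p.1 i) * F (Function.update p.1 i p.2) = _
  rw [← this]

lemma prodExp_eq_exps {Ω : Type} [Fintype Ω] {ℓ n : ℕ}
    (P : (Fin ℓ → Ω) → ℝ) (f : Fin ℓ → ((Fin n → Ω) → ℝ)) :
    prodExp P f = exps P (fun v : Fin n → Fin ℓ → Ω => ∏ j, f j (fun k => v k j)) := by
  unfold prodExp exps
  exact Fintype.sum_equiv (Equiv.piComm (fun (_ : Fin ℓ) (_ : Fin n) => Ω)) _ _ (fun x => rfl)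

lemma prodExp_split {Ω : Type} [Fintype Ω] {ℓ n : ℕ}
    (P : (Fin ℓ → Ω) → ℝ) (hP : IsDist P) (f : Fin ℓ → ((Fin n → Ω) → ℝ)) (i : Fin n) :
    prodExp P f = ∑ a, P a * prodExp P (fun j => restrOp i (a j) (f j)) := by
  rw [prodExp_eq_exps, exps_resample P hP.2 i]
  apply Finset.sum_congr rfl
  intro a _
  rw [prodExp_eq_exps]
  congr 2
  funext v
  unfold restrOp
  apply Finset.prod_congr rfl
  intro j _
  congr 1
  funext k
  by_cases h : k = i
  · subst h; simp
  · simp [Function.update_of_ne h]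

lemma prodExp_nonneg {Ω : Type} [Fintype Ω] {ℓ n : ℕ}
    (P : (Fin ℓ → Ω) → ℝ) (hP : ∀ x, 0 ≤ P x) (f : Fin ℓ → ((Fin n → Ω) → ℝ))
    (hf : ∀ j v, 0 ≤ f j v) : 0 ≤ prodExp P f := by
  unfold prodExp
  apply Finset.sum_nonneg
  intro x _
  exact mul_nonneg (Finset.prod_nonneg fun _ _ => hP _) (Finset.prod_nonneg fun _ _ => hf _ _)

/-- Splitting off the coordinate `j`. -/
lemma sum_ins {Ω : Type} [Fintype Ω] {ℓ : ℕ} (j : Fin ℓ) (F : (Fin ℓ → Ω) → ℝ) :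
    ∑ w : {k : Fin ℓ // k ≠ j} → Ω, ∑ a, F (ins j w a) = ∑ x, F x := by
  rw [← Fintype.sum_prod_type' (fun w a => F (ins j w a))]
  let e : (({k : Fin ℓ // k ≠ j} → Ω) × Ω) ≃ (Fin ℓ → Ω) :=
    { toFun := fun p => ins j p.1 p.2
      invFun := fun x => (fun k => x k, x j)
      left_inv := by
        rintro ⟨w, a⟩
        ext k
        · simp [ins, k.2]
        · simp [ins]
      right_inv := by
        intro x
        funext k
        by_cases h : k = j
        · subst h; simp [ins]
        · simp [ins, h] }
  exact Fintype.sum_equiv e _ _ (fun p => rfl)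

lemma sum_marg {Ω : Type} [Fintype Ω] {ℓ : ℕ} (P : (Fin ℓ → Ω) → ℝ) (π : Ω → ℝ)
    (hm : HasMarginals P π) (j : Fin ℓ) (h : Ω → ℝ) :
    ∑ x, P x * h (x j) = ∑ a, π a * h a := by
  classical
  have : ∀ a, π a = ∑ x : Fin ℓ → Ω, if x j = a then P x else 0 := by
    intro a
    rw [← hm j a]
    unfold marginal
    apply Finset.sum_congr rfl
    intro x _
    congr
  simp_rw [this, Finset.sum_mul]
  rw [Finset.sum_comm]
  apply Finset.sum_congr rfl
  intro x _
  simp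

lemma varP_sub_nonneg {Ω : Type} [Fintype Ω] {ℓ : ℕ} (P : (Fin ℓ → Ω) → ℝ) (hP : IsDist P)
    (f g : (Fin ℓ → Ω) → ℝ) : 2 * covP P f g ≤ varP P f + varP P g := by
  have h : 0 ≤ ∑ x, P x * ((f x - g x) - (expP P f - expP P g)) ^ 2 :=
    Finset.sum_nonneg fun x _ => mul_nonneg (hP.1 x) (sq_nonneg _)
  have e : ∑ x, P x * ((f x - g x) - (expP P f - expP P g)) ^ 2
      = varP P f + varP P g - 2 * covP P f g := by
    have e1 : ∀ x, P x * ((f x - g x) - (expP P f - expP P g)) ^ 2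
        = P x * (f x * f x) + P x * (g x * g x) - 2 * (P x * (f x * g x))
          - 2 * (expP P f - expP P g) * (P x * f x) + 2 * (expP P f - expP P g) * (P x * g x)
          + (expP P f - expP P g) ^ 2 * P x := by
      intro x; ring
    simp_rw [e1]
    simp only [Finset.sum_add_distrib, Finset.sum_sub_distrib, ← Finset.mul_sum, hP.2]
    unfold varP covP
    have a1 : ∑ x, P x * f x = expP P f := rfl
    have a2 : ∑ x, P x * g x = expP P g := rfl
    have a3 : ∑ x, P x * (f x * f x) = expP P (fun x => f x * f x) := rfl
    have a4 : ∑ x, P x * (g x * g x) = expP P (fun x => g x * g x) := rfl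
    have a5 : ∑ x, P x * (f x * g x) = expP P (fun x => f x * g x) := rfl
    rw [a1, a2, a3, a4, a5]
    ring
  linarith

lemma expP_smul {Ω : Type} [Fintype Ω] {ℓ : ℕ} (P : (Fin ℓ → Ω) → ℝ) (c : ℝ)
    (f : (Fin ℓ → Ω) → ℝ) : expP P (fun x => c * f x) = c * expP P f := by
  unfold expP
  rw [Finset.mul_sum]
  apply Finset.sum_congr rfl
  intro x _
  ring

lemma covP_smul {Ω : Type} [Fintype Ω] {ℓ : ℕ} (P : (Fin ℓ → Ω) → ℝ) (c d : ℝ)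
    (f g : (Fin ℓ → Ω) → ℝ) :
    covP P (fun x => c * f x) (fun x => d * g x) = c * d * covP P f g := by
  have : (fun x => c * f x * (d * g x)) = (fun x => (c * d) * (f x * g x)) := by
    funext x; ring
  unfold covP
  rw [this, expP_smul, expP_smul, expP_smul]
  ring

lemma varP_nonneg {Ω : Type} [Fintype Ω] {ℓ : ℕ} (P : (Fin ℓ → Ω) → ℝ) (hP : IsDist P)
    (f : (Fin ℓ → Ω) → ℝ) : 0 ≤ varP P f := by
  have h := varP_sub_nonneg P hP f (fun x => (-1) * f x)
  have h1 : covP P f (fun x => (-1) * f x) = - varP P f := by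
    have := covP_smul P 1 (-1) f f
    simp only [one_mul] at this
    rw [this]; unfold varP; ring
  have h2 : varP P (fun x => (-1) * f x) = varP P f := by
    unfold varP; rw [covP_smul]; ring
  rw [h1, h2] at h
  linarith

lemma rho_bdd {Ω : Type} [Fintype Ω] {ℓ : ℕ} (P : (Fin ℓ → Ω) → ℝ) (hP : IsDist P)
    (S T : Finset (Fin ℓ)) (f g : (Fin ℓ → Ω) → ℝ) (hf : DependsOn f S) (hg : DependsOn g T)
    (hf1 : varP P f = 1) (hg1 : varP P g = 1) : covP P f g ≤ rhoST P S T := by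
  apply le_csSup
  · refine ⟨1, ?_⟩
    rintro r ⟨f, g, _, _, h1, h2, rfl⟩
    have := varP_sub_nonneg P hP f g
    linarith
  · exact ⟨f, g, hf, hg, hf1, hg1, rfl⟩

lemma rhoST_nonneg {Ω : Type} [Fintype Ω] {ℓ : ℕ} (P : (Fin ℓ → Ω) → ℝ)
    (S T : Finset (Fin ℓ)) : 0 ≤ rhoST P S T := by
  unfold rhoST
  by_cases h : ∃ f g : (Fin ℓ → Ω) → ℝ, DependsOn f S ∧ DependsOn g T ∧
    varP P f = 1 ∧ varP P g = 1
  · obtain ⟨f, g, hf, hg, h1, h2⟩ := h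
    apply Real.sSup_nonneg'
    rcases le_total 0 (covP P f g) with h | h
    · exact ⟨_, ⟨f, g, hf, hg, h1, h2, rfl⟩, h⟩
    · refine ⟨- covP P f g, ⟨f, fun x => (-1) * g x, hf, ?_, h1, ?_, ?_⟩, by linarith⟩
      · intro x y hxy
        simp only [hg x y hxy]
      · unfold varP; rw [covP_smul]; unfold varP at h2; rw [h2]; norm_num
      · have := covP_smul P 1 (-1) f g
        simp only [one_mul] at this
        rw [this]; ring
  · apply Real.sSup_nonneg
    rintro r ⟨f, g, hf, hg, h1, h2, rfl⟩
    exact absurd ⟨f, g, hf, hg, h1, h2⟩ h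

lemma rhoST_le_rho {Ω : Type} [Fintype Ω] {ℓ : ℕ} (P : (Fin ℓ → Ω) → ℝ) (j : Fin ℓ) :
    rhoST P {j} ({j}ᶜ) ≤ rho P :=
  le_ciSup (f := fun j : Fin ℓ => rhoST P {j} ({j}ᶜ)) (Set.finite_range _).bddAbove j

lemma var_le_of_cov {Ω : Type} [Fintype Ω] {ℓ : ℕ} (P : (Fin ℓ → Ω) → ℝ) (hP : IsDist P)
    (j : Fin ℓ) (ρ : ℝ) (hρ : rho P ≤ ρ) (F G : (Fin ℓ → Ω) → ℝ) (hF : DependsOn F {j})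
    (hG : DependsOn G ({j}ᶜ)) (hc : covP P F G = varP P G) :
    varP P G ≤ ρ ^ 2 * varP P F := by
  have hV := varP_nonneg P hP G
  have hU := varP_nonneg P hP F
  have hUV := varP_sub_nonneg P hP F G
  rcases hV.eq_or_lt with h | hV0
  · rw [← h]; positivity
  have hU0 : 0 < varP P F := by linarith
  set U := varP P F with hUdef
  set V := varP P G with hVdef
  have sU : 0 < Real.sqrt U := Real.sqrt_pos.2 hU0
  have sV : 0 < Real.sqrt V := Real.sqrt_pos.2 hV0
  have qU : Real.sqrt U * Real.sqrt U = U := Real.mul_self_sqrt hU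
  have qV : Real.sqrt V * Real.sqrt V = V := Real.mul_self_sqrt hV
  have hb := rho_bdd P hP {j} ({j}ᶜ) (fun x => (Real.sqrt U)⁻¹ * F x)
    (fun x => (Real.sqrt V)⁻¹ * G x) (fun x y h => by simp only [hF x y h])
    (fun x y h => by simp only [hG x y h])
    (by
      unfold varP
      rw [covP_smul]
      change _ * U = 1
      rw [← mul_inv, qU, inv_mul_cancel₀ hU0.ne'])
    (by
      unfold varP
      rw [covP_smul]
      change _ * V = 1
      rw [← mul_inv, qV, inv_mul_cancel₀ hV0.ne'])
  rw [covP_smul, hc] at hb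
  have hb2 := hb.trans ((rhoST_le_rho P j).trans hρ)
  have e : (Real.sqrt U)⁻¹ * (Real.sqrt V)⁻¹ * V = Real.sqrt V / Real.sqrt U := by
    field_simp
    nlinarith [qV]
  rw [e, div_le_iff₀ sU] at hb2
  calc V = Real.sqrt V * Real.sqrt V := qV.symm
    _ ≤ (ρ * Real.sqrt U) * (ρ * Real.sqrt U) := by
        exact mul_le_mul hb2 hb2 sV.le (sV.le.trans hb2)
    _ = ρ ^ 2 * (Real.sqrt U * Real.sqrt U) := by ring
    _ = ρ ^ 2 * U := by rw [qU]

/-- The weight of a double sample. -/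
noncomputable def dsw {Ω : Type} [Fintype Ω] {ℓ : ℕ} (P : (Fin ℓ → Ω) → ℝ) (j : Fin ℓ)
    (w : {k : Fin ℓ // k ≠ j} → Ω) (y z : Ω) : ℝ :=
  P (ins j w y) * P (ins j w z) / margOff P j w

lemma le_margOff {Ω : Type} [Fintype Ω] {ℓ : ℕ} (P : (Fin ℓ → Ω) → ℝ) (hP : ∀ x, 0 ≤ P x)
    (j : Fin ℓ) (w : {k : Fin ℓ // k ≠ j} → Ω) (y : Ω) : P (ins j w y) ≤ margOff P j w :=
  Finset.single_le_sum (f := fun a => P (ins j w a)) (fun a _ => hP _) (Finset.mem_univ y)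

lemma dsw_nonneg {Ω : Type} [Fintype Ω] {ℓ : ℕ} (P : (Fin ℓ → Ω) → ℝ) (hP : ∀ x, 0 ≤ P x)
    (j : Fin ℓ) (w : {k : Fin ℓ // k ≠ j} → Ω) (y z : Ω) : 0 ≤ dsw P j w y z :=
  div_nonneg (mul_nonneg (hP _) (hP _)) ((hP _).trans (le_margOff P hP j w y))

lemma dsw_comm {Ω : Type} [Fintype Ω] {ℓ : ℕ} (P : (Fin ℓ → Ω) → ℝ)
    (j : Fin ℓ) (w : {k : Fin ℓ // k ≠ j} → Ω) (y z : Ω) : dsw P j w y z = dsw P j w z y := by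
  unfold dsw; rw [mul_comm (P _)]

lemma sum_dsw {Ω : Type} [Fintype Ω] {ℓ : ℕ} (P : (Fin ℓ → Ω) → ℝ) (hP : ∀ x, 0 ≤ P x)
    (j : Fin ℓ) (w : {k : Fin ℓ // k ≠ j} → Ω) (y : Ω) :
    ∑ z, dsw P j w y z = P (ins j w y) := by
  unfold dsw
  rw [← Finset.sum_div, ← Finset.mul_sum]
  change P (ins j w y) * margOff P j w / margOff P j w = _
  by_cases h : margOff P j w = 0
  · have := le_margOff P hP j w y
    have := hP (ins j w y)
    rw [h]; simp; linarith
  · field_simp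

lemma dsw_le {Ω : Type} [Fintype Ω] {ℓ : ℕ} (P : (Fin ℓ → Ω) → ℝ) (hP : ∀ x, 0 ≤ P x)
    (j : Fin ℓ) (w : {k : Fin ℓ // k ≠ j} → Ω) (y z : Ω) : dsw P j w y z ≤ P (ins j w y) := by
  rw [← sum_dsw P hP j w y]
  exact Finset.single_le_sum (f := fun z => dsw P j w y z)
    (fun a _ => dsw_nonneg P hP j w y a) (Finset.mem_univ z)

/-- Averages over the double sample of functions of `(w, y)`. -/
lemma sum_dsw_left {Ω : Type} [Fintype Ω] {ℓ : ℕ} (P : (Fin ℓ → Ω) → ℝ) (hP : ∀ x, 0 ≤ P x)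
    (j : Fin ℓ) (F : (Fin ℓ → Ω) → ℝ) :
    ∑ w, ∑ y, ∑ z, dsw P j w y z * F (ins j w y) = ∑ x, P x * F x := by
  rw [← sum_ins j]
  apply Finset.sum_congr rfl
  intro w _
  apply Finset.sum_congr rfl
  intro y _
  rw [← Finset.sum_mul, sum_dsw P hP]

lemma sum_dsw_right {Ω : Type} [Fintype Ω] {ℓ : ℕ} (P : (Fin ℓ → Ω) → ℝ) (hP : ∀ x, 0 ≤ P x)
    (j : Fin ℓ) (F : (Fin ℓ → Ω) → ℝ) :
    ∑ w, ∑ y, ∑ z, dsw P j w y z * F (ins j w z) = ∑ x, P x * F x := by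
  rw [← sum_dsw_left P hP j]
  apply Finset.sum_congr rfl
  intro w _
  rw [Finset.sum_comm]
  simp_rw [dsw_comm P j w]

lemma ins_self {Ω : Type} {ℓ : ℕ} (j : Fin ℓ) (w : {k : Fin ℓ // k ≠ j} → Ω) (a : Ω) :
    ins j w a j = a := by simp [ins]

lemma ins_ne {Ω : Type} {ℓ : ℕ} (j : Fin ℓ) (w : {k : Fin ℓ // k ≠ j} → Ω) (a : Ω)
    (k : Fin ℓ) (h : k ≠ j) : ins j w a k = w ⟨k, h⟩ := by simp [ins, h]

/-- The correlation bound for the double sample. -/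
lemma dsw_cov {Ω : Type} [Fintype Ω] {ℓ : ℕ} (P : (Fin ℓ → Ω) → ℝ) (π : Ω → ℝ)
    (hP : IsDist P) (hm : HasMarginals P π) (j : Fin ℓ) (ρ : ℝ) (hρ : rho P ≤ ρ) (h : Ω → ℝ) :
    ∑ w, ∑ y, ∑ z, dsw P j w y z * (h y * h z) - expPi π h ^ 2
      ≤ ρ ^ 2 * (expPi π (fun a => h a ^ 2) - expPi π h ^ 2) := by
  let N : ({k : Fin ℓ // k ≠ j} → Ω) → ℝ := fun w => ∑ y, P (ins j w y) * h y
  let F : (Fin ℓ → Ω) → ℝ := fun x => h (x j)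
  let H : ({k : Fin ℓ // k ≠ j} → Ω) → ℝ := fun w => N w / margOff P j w
  let G : (Fin ℓ → Ω) → ℝ := fun x => H (fun k => x k)
  have hGi : ∀ w a, G (ins j w a) = H w := by
    intro w a
    show H _ = H w
    congr 1
    funext k
    exact ins_ne j w a k.1 k.2
  have hmN : ∀ w, margOff P j w * H w = N w := by
    intro w
    show margOff P j w * (N w / margOff P j w) = N w
    by_cases h0 : margOff P j w = 0
    · have : N w = 0 := by
        apply Finset.sum_eq_zero
        intro y _
        have h1 := le_margOff P hP.1 j w y
        have h2 := hP.1 (ins j w y)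
        have : P (ins j w y) = 0 := by linarith
        rw [this, zero_mul]
      rw [this]; simp
    · field_simp
  have hF : expP P F = expPi π h := sum_marg P π hm j h
  have hFF : expP P (fun x => F x * F x) = expPi π (fun a => h a ^ 2) := by
    have := sum_marg P π hm j (fun a => h a ^ 2)
    unfold expPi
    rw [← this]
    apply Finset.sum_congr rfl
    intro x _
    show P x * (h (x j) * h (x j)) = _
    ring
  have hG : expP P G = expP P F := by
    unfold expP
    rw [← sum_ins j, ← sum_ins j]
    apply Finset.sum_congr rfl
    intro w _
    simp_rw [hGi]
    rw [← Finset.sum_mul]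
    change margOff P j w * H w = _
    rw [hmN]
    apply Finset.sum_congr rfl
    intro y _
    show _ = _ * h (ins j w y j)
    rw [ins_self]
  have hGG : expP P (fun x => G x * G x) = ∑ w, N w * H w := by
    unfold expP
    rw [← sum_ins j]
    apply Finset.sum_congr rfl
    intro w _
    simp_rw [hGi]
    rw [← Finset.sum_mul]
    change margOff P j w * (H w * H w) = _
    rw [← mul_assoc, hmN]
  have hFG : expP P (fun x => F x * G x) = ∑ w, N w * H w := by
    unfold expP
    rw [← sum_ins j]
    apply Finset.sum_congr rfl
    intro w _
    simp_rw [hGi]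
    show _ = (∑ y, P (ins j w y) * h y) * H w
    rw [Finset.sum_mul]
    apply Finset.sum_congr rfl
    intro y _
    show _ * (h (ins j w y j) * _) = _
    rw [ins_self]
    ring
  have hD : ∑ w, ∑ y, ∑ z, dsw P j w y z * (h y * h z) = ∑ w, N w * H w := by
    apply Finset.sum_congr rfl
    intro w _
    show _ = (∑ y, P (ins j w y) * h y) * ((∑ z, P (ins j w z) * h z) / margOff P j w)
    rw [← mul_div_assoc, Finset.sum_mul_sum, Finset.sum_div]
    apply Finset.sum_congr rfl
    intro y _
    rw [Finset.sum_div]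
    apply Finset.sum_congr rfl
    intro z _
    unfold dsw
    ring
  have key := var_le_of_cov P hP j ρ hρ F G
    (by
      intro x y hxy
      show h (x j) = h (y j)
      rw [hxy j (by simp)])
    (by
      intro x y hxy
      show H _ = H _
      congr 1
      funext k
      exact hxy k.1 (by simpa using k.2))
    (by
      unfold varP covP
      rw [hFG, hGG, hG])
  unfold varP covP at key
  rw [hGG, hG, hFF, hF] at key
  rw [hD]
  nlinarith [key]

lemma varPi_eq {Ω : Type} [Fintype Ω] (π : Ω → ℝ) (hπ : ∑ a, π a = 1) (h : Ω → ℝ) :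
    varPi π h = expPi π (fun a => h a ^ 2) - expPi π h ^ 2 := by
  unfold varPi
  set m := expPi π h with hmdef
  have e : ∀ a, π a * (h a - m) ^ 2 = π a * h a ^ 2 - 2 * m * (π a * h a) + m ^ 2 * π a := by
    intro a; ring
  unfold expPi
  simp_rw [e]
  rw [Finset.sum_add_distrib, Finset.sum_sub_distrib, ← Finset.mul_sum, ← Finset.mul_sum, hπ]
  change _ - 2 * m * expPi π h + _ = _
  rw [← hmdef]
  ring

lemma dsw_max {Ω : Type} [Fintype Ω] {ℓ : ℕ} (P : (Fin ℓ → Ω) → ℝ) (π : Ω → ℝ)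
    (hP : IsDist P) (hm : HasMarginals P π) (hπ : ∑ a, π a = 1)
    (j : Fin ℓ) (ρ : ℝ) (hρ : rho P ≤ ρ) (h : Ω → ℝ)
    (hh : ∀ a, h a ∈ Set.Icc (0 : ℝ) 1) :
    expPi π h + (1 - ρ ^ 2) * varPi π h
      ≤ ∑ w, ∑ y, ∑ z, dsw P j w y z * max (h y) (h z) := by
  have hpt : ∀ y z, (h y + h z) / 2 + (h y - h z) ^ 2 / 2 ≤ max (h y) (h z) := by
    intro y z
    obtain ⟨a0, a1⟩ := hh y
    obtain ⟨b0, b1⟩ := hh z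
    rcases le_total (h y) (h z) with hle | hle
    · rw [max_eq_right hle]; nlinarith
    · rw [max_eq_left hle]; nlinarith
  have step : ∑ w, ∑ y, ∑ z, dsw P j w y z * ((h y + h z) / 2 + (h y - h z) ^ 2 / 2)
      ≤ ∑ w, ∑ y, ∑ z, dsw P j w y z * max (h y) (h z) := by
    refine Finset.sum_le_sum fun w _ => Finset.sum_le_sum fun y _ =>
      Finset.sum_le_sum fun z _ => ?_
    exact mul_le_mul_of_nonneg_left (hpt y z) (dsw_nonneg P hP.1 j w y z)
  have l1 := sum_dsw_left P hP.1 j (fun x => h (x j))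
  have r1 := sum_dsw_right P hP.1 j (fun x => h (x j))
  have l2 := sum_dsw_left P hP.1 j (fun x => h (x j) ^ 2)
  have r2 := sum_dsw_right P hP.1 j (fun x => h (x j) ^ 2)
  rw [sum_marg P π hm j h] at l1 r1
  rw [sum_marg P π hm j (fun a => h a ^ 2)] at l2 r2
  simp only [ins_self] at l1 r1 l2 r2
  have e : ∀ w y z, dsw P j w y z * ((h y + h z) / 2 + (h y - h z) ^ 2 / 2)
      = 1 / 2 * (dsw P j w y z * h y) + 1 / 2 * (dsw P j w y z * h z)
        + 1 / 2 * (dsw P j w y z * h y ^ 2) + 1 / 2 * (dsw P j w y z * h z ^ 2)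
        - dsw P j w y z * (h y * h z) := by
    intro w y z; ring
  simp_rw [e] at step
  simp only [Finset.sum_add_distrib, Finset.sum_sub_distrib, ← Finset.mul_sum, l1, r1, l2, r2]
    at step
  have c := dsw_cov P π hP hm j ρ hρ h
  rw [varPi_eq π hπ]
  have a1 : ∑ a, π a * h a = expPi π h := rfl
  have a2 : ∑ a, π a * h a ^ 2 = expPi π (fun a => h a ^ 2) := rfl
  rw [a1, a2] at step
  linarith

/-- a single influence-reduction step. -/
theorem second_reduction_single_step
    {Ω : Type} [Fintype Ω] {ℓ n : ℕ}
    (P : (Fin ℓ → Ω) → ℝ) (π : Ω → ℝ)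
    (hP : IsDist P) (hm : HasMarginals P π) (hπ : ∀ a : Ω, 0 < π a)
    (f : Fin ℓ → ((Fin n → Ω) → ℝ)) (hf : ∀ j v, f j v ∈ Set.Icc (0:ℝ) 1)
    (i : Fin n) (jstar : Fin ℓ) (τ ρ : ℝ)
    (hτ0 : 0 ≤ τ) (hτ : τ ≤ influence π i (f jstar))
    (hρ : rho P ≤ ρ) (hρ1 : ρ ≤ 1) :
    ∃ (xbar : {k : Fin ℓ // k ≠ jstar} → Ω) (y z : Ω)
      (g : Fin ℓ → ((Fin n → Ω) → ℝ)),
      g jstar = maxOp i y z (f jstar) ∧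
      (∀ (j : Fin ℓ) (h : j ≠ jstar), g j = restrOp i (xbar ⟨j, h⟩) (f j)) ∧
      (∑ j, exps π (f j)) + τ * (1 - ρ^2) / 2 ≤ (∑ j, exps π (g j)) ∧
      τ * (1 - ρ^2) / (2 * ℓ * (Fintype.card Ω : ℝ) ^ (ℓ + 1)) * prodExp P g
        ≤ prodExp P f := by
  classical
  have hℓ : 0 < (ℓ : ℝ) := by
    have := jstar.pos
    exact_mod_cast this
  have hπ0 : ∀ a, 0 ≤ π a := fun a => (hπ a).le
  have hπ1 : ∑ a, π a = 1 := by
    have := sum_marg P π hm jstar (fun _ => 1)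
    simp only [mul_one] at this
    rw [← this, hP.2]
  have hΩ : Nonempty Ω := by
    by_contra hne
    rw [not_nonempty_iff] at hne
    simp at hπ1
  have hcard : 0 < (Fintype.card Ω : ℝ) := by exact_mod_cast Fintype.card_pos
  have hρ0 : 0 ≤ ρ := (rhoST_nonneg P {jstar} ({jstar}ᶜ)).trans ((rhoST_le_rho P jstar).trans hρ)
  have hρ2 : 0 ≤ 1 - ρ ^ 2 := by nlinarith
  set c : ℝ := τ * (1 - ρ ^ 2) / 2 with hc
  have hc0 : 0 ≤ c := by positivity
  set β : ℝ := τ * (1 - ρ^2) / (2 * ℓ * (Fintype.card Ω : ℝ) ^ (ℓ + 1)) with hβ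
  have hβ0 : 0 ≤ β := by positivity
  have hβc : β * (Fintype.card Ω : ℝ) ^ (ℓ + 1) * ℓ = c := by
    rw [hβ, hc]; field_simp
  have hpw : ∀ v : Fin n → Ω, 0 ≤ ∏ k, π (v k) := fun v => Finset.prod_nonneg fun _ _ => hπ0 _
  have hpw1 : ∑ v : Fin n → Ω, ∏ k, π (v k) = 1 := by
    rw [← Fintype.prod_sum (fun (_ : Fin n) a => π a)]
    simp [hπ1]
  have hexps0 : ∀ F : (Fin n → Ω) → ℝ, (∀ v, 0 ≤ F v) → 0 ≤ exps π F := fun F hF =>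
    Finset.sum_nonneg fun v _ => mul_nonneg (hpw v) (hF v)
  have hexps1 : ∀ F : (Fin n → Ω) → ℝ, (∀ v, F v ≤ 1) → exps π F ≤ 1 := by
    intro F hF
    rw [← hpw1]
    exact Finset.sum_le_sum fun v _ => mul_le_of_le_one_right (hpw v) (hF v)
  let g : ({k : Fin ℓ // k ≠ jstar} → Ω) → Ω → Ω → Fin ℓ → ((Fin n → Ω) → ℝ) :=
    fun w y z j => if h : j = jstar then maxOp i y z (f jstar) else restrOp i (w ⟨j, h⟩) (f j)
  have hgs : ∀ w y z, g w y z jstar = maxOp i y z (f jstar) := fun w y z => by simp [g]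
  have hgn : ∀ w y z j (h : j ≠ jstar), g w y z j = restrOp i (w ⟨j, h⟩) (f j) :=
    fun w y z j h => by simp [g, h]
  have hg01 : ∀ w y z j v, g w y z j v ∈ Set.Icc (0:ℝ) 1 := by
    intro w y z j v
    by_cases h : j = jstar
    · subst h
      rw [hgs]
      exact ⟨le_max_of_le_left (hf _ _).1, max_le (hf _ _).2 (hf _ _).2⟩
    · rw [hgn w y z j h]
      exact hf _ _
  -- expected value of the new sums
  have hother : ∀ j, j ≠ jstar →
      ∑ w, ∑ y, ∑ z, dsw P jstar w y z * exps π (g w y z j) = exps π (f j) := by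
    intro j hj
    rw [exps_resample π hπ1 i (f j), ← sum_marg P π hm j (fun a => exps π (restrOp i a (f j))),
      ← sum_dsw_left P hP.1 jstar]
    refine Finset.sum_congr rfl fun w _ => Finset.sum_congr rfl fun y _ =>
      Finset.sum_congr rfl fun z _ => ?_
    rw [hgn w y z j hj, ins_ne jstar w y j hj]
  have hstar : exps π (f jstar) + 2 * c
      ≤ ∑ w, ∑ y, ∑ z, dsw P jstar w y z * exps π (g w y z jstar) := by
    have e1 : ∑ w, ∑ y, ∑ z, dsw P jstar w y z * exps π (g w y z jstar)
        = ∑ v : Fin n → Ω, (∏ k, π (v k)) * ∑ w, ∑ y, ∑ z, dsw P jstar w y z *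
          max (f jstar (Function.update v i y)) (f jstar (Function.update v i z)) := by
      simp_rw [hgs]
      unfold exps maxOp
      simp_rw [Finset.mul_sum]
      rw [sum_swap3]
      refine Finset.sum_congr rfl fun v _ => Finset.sum_congr rfl fun w _ =>
        Finset.sum_congr rfl fun y _ => Finset.sum_congr rfl fun z _ => ?_
      ring
    have e2 : exps π (f jstar)
        = ∑ v : Fin n → Ω, (∏ k, π (v k)) *
          expPi π (fun a => f jstar (Function.update v i a)) := by
      rw [exps_resample π hπ1 i]
      unfold exps expPi restrOp
      simp_rw [Finset.mul_sum]
      rw [Finset.sum_comm]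
      refine Finset.sum_congr rfl fun v _ => Finset.sum_congr rfl fun a _ => ?_
      ring
    have e3 : exps π (f jstar) + (1 - ρ ^ 2) * influence π i (f jstar)
        ≤ ∑ w, ∑ y, ∑ z, dsw P jstar w y z * exps π (g w y z jstar) := by
      rw [e1, e2]
      unfold influence
      rw [Finset.mul_sum, ← Finset.sum_add_distrib]
      refine Finset.sum_le_sum fun v _ => ?_
      have := mul_le_mul_of_nonneg_left
        (dsw_max P π hP hm hπ1 jstar ρ hρ (fun a => f jstar (Function.update v i a))
          (fun a => hf _ _)) (hpw v)
      linarith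
    have e4 : 2 * c ≤ (1 - ρ ^ 2) * influence π i (f jstar) := by
      rw [hc]
      nlinarith [mul_le_mul_of_nonneg_left hτ hρ2]
    linarith
  have hmass : ∑ w, ∑ y, ∑ z, dsw P jstar w y z = 1 := by
    have := sum_dsw_left P hP.1 jstar (fun _ => 1)
    simp only [mul_one] at this
    rw [this, hP.2]
  have htot : ∑ j, exps π (f j) + 2 * c
      ≤ ∑ w, ∑ y, ∑ z, dsw P jstar w y z * ∑ j, exps π (g w y z j) := by
    have e : ∑ w, ∑ y, ∑ z, dsw P jstar w y z * ∑ j, exps π (g w y z j)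
        = ∑ j, ∑ w, ∑ y, ∑ z, dsw P jstar w y z * exps π (g w y z j) := by
      simp_rw [Finset.mul_sum]
      rw [sum_swap3]
    rw [e, ← Finset.add_sum_erase _ _ (Finset.mem_univ jstar),
      ← Finset.add_sum_erase (Finset.univ : Finset (Fin ℓ)) _ (Finset.mem_univ jstar)]
    have : ∑ j ∈ Finset.univ.erase jstar,
        ∑ w, ∑ y, ∑ z, dsw P jstar w y z * exps π (g w y z j)
        = ∑ j ∈ Finset.univ.erase jstar, exps π (f j) :=
      Finset.sum_congr rfl fun j hj => hother j (Finset.ne_of_mem_erase hj)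
    rw [this]
    linarith
  -- the bad triples
  let bad : ({k : Fin ℓ // k ≠ jstar} → Ω) → Ω → Ω → ℝ := fun w y z =>
    if P (ins jstar w y) < β ∨ P (ins jstar w z) < β then 1 else 0
  have hbad : ∑ w, ∑ y, ∑ z, dsw P jstar w y z * bad w y z
      ≤ β * (Fintype.card Ω : ℝ) ^ (ℓ + 1) := by
    have h1 : ∑ w, ∑ y, ∑ z, dsw P jstar w y z * bad w y z
        ≤ ∑ w : {k : Fin ℓ // k ≠ jstar} → Ω, ∑ y : Ω, ∑ z : Ω, β := by
      refine Finset.sum_le_sum fun w _ => Finset.sum_le_sum fun y _ =>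
        Finset.sum_le_sum fun z _ => ?_
      by_cases h : P (ins jstar w y) < β ∨ P (ins jstar w z) < β
      · simp only [bad, if_pos h, mul_one]
        rcases h with h | h
        · exact (dsw_le P hP.1 jstar w y z).trans h.le
        · rw [dsw_comm]
          exact (dsw_le P hP.1 jstar w z y).trans h.le
      · simp only [bad, if_neg h, mul_zero]
        exact hβ0
    refine h1.trans (le_of_eq ?_)
    obtain ⟨m, hm'⟩ : ∃ m, ℓ = m + 1 := ⟨ℓ - 1, by have := jstar.pos; omega⟩
    have hcs : Fintype.card {k : Fin ℓ // k ≠ jstar} = m := by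
      rw [Fintype.card_subtype_compl]
      simp [hm']
    simp only [Finset.sum_const, Finset.card_univ, nsmul_eq_mul, Fintype.card_fun, hcs]
    rw [hm']
    push_cast
    ring
  have hex : ∃ w y z, ∑ j, exps π (f j) + c + ℓ * bad w y z ≤ ∑ j, exps π (g w y z j) := by
    by_contra hno
    push Not at hno
    have hle : ∀ w y z, dsw P jstar w y z * ∑ j, exps π (g w y z j)
        ≤ dsw P jstar w y z * (∑ j, exps π (f j) + c + ℓ * bad w y z) := fun w y z =>
      mul_le_mul_of_nonneg_left (hno w y z).le (dsw_nonneg P hP.1 jstar w y z)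
    have hR : ∑ w, ∑ y, ∑ z, dsw P jstar w y z * (∑ j, exps π (f j) + c + ℓ * bad w y z)
        ≤ ∑ j, exps π (f j) + 2 * c := by
      have e : ∀ w y z, dsw P jstar w y z * (∑ j, exps π (f j) + c + ℓ * bad w y z)
          = (∑ j, exps π (f j) + c) * dsw P jstar w y z
            + ℓ * (dsw P jstar w y z * bad w y z) := by
        intro w y z; ring
      simp_rw [e]
      simp only [Finset.sum_add_distrib]
      simp only [← Finset.mul_sum, hmass]
      have := mul_le_mul_of_nonneg_left hbad hℓ.le
      linarith
    have hpos : ∃ w y z, 0 < dsw P jstar w y z := by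
      by_contra hz
      push Not at hz
      have : ∑ w, ∑ y, ∑ z, dsw P jstar w y z ≤ 0 :=
        Finset.sum_nonpos fun w _ => Finset.sum_nonpos fun y _ =>
          Finset.sum_nonpos fun z _ => hz w y z
      linarith
    obtain ⟨w0, y0, z0, h0⟩ := hpos
    have hlt : ∑ w, ∑ y, ∑ z, dsw P jstar w y z * ∑ j, exps π (g w y z j)
        < ∑ w, ∑ y, ∑ z, dsw P jstar w y z * (∑ j, exps π (f j) + c + ℓ * bad w y z) := by
      refine Finset.sum_lt_sum (fun w _ => Finset.sum_le_sum fun y _ =>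
        Finset.sum_le_sum fun z _ => hle w y z) ⟨w0, Finset.mem_univ _, ?_⟩
      refine Finset.sum_lt_sum (fun y _ =>
        Finset.sum_le_sum fun z _ => hle w0 y z) ⟨y0, Finset.mem_univ _, ?_⟩
      refine Finset.sum_lt_sum (fun z _ => hle w0 y0 z) ⟨z0, Finset.mem_univ _, ?_⟩
      exact mul_lt_mul_of_pos_left (hno w0 y0 z0) h0
    linarith
  obtain ⟨w, y, z, hwyz⟩ := hex
  have hf0 : 0 ≤ ∑ j, exps π (f j) :=
    Finset.sum_nonneg fun j _ => hexps0 _ fun v => (hf j v).1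
  have hg1 : ∑ j, exps π (g w y z j) ≤ ℓ := by
    calc ∑ j, exps π (g w y z j) ≤ ∑ j : Fin ℓ, (1 : ℝ) :=
          Finset.sum_le_sum fun j _ => hexps1 _ fun v => (hg01 w y z j v).2
      _ = ℓ := by simp
  have hgood : β ≤ P (ins jstar w y) ∧ β ≤ P (ins jstar w z) := by
    by_contra hb
    have hb' : P (ins jstar w y) < β ∨ P (ins jstar w z) < β := by
      by_contra hcon
      push Not at hcon
      exact hb hcon
    have hb1 : bad w y z = 1 := by simp only [bad, if_pos hb']
    rw [hb1] at hwyz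
    have hcz : c = 0 := by linarith
    have hβz : β = 0 := by
      rw [hcz] at hβc
      have : (Fintype.card Ω : ℝ) ^ (ℓ + 1) * ℓ ≠ 0 := by positivity
      rw [mul_assoc] at hβc
      exact (mul_eq_zero.1 hβc).resolve_right this
    rw [hβz] at hb'
    rcases hb' with h | h
    · linarith [hP.1 (ins jstar w y)]
    · linarith [hP.1 (ins jstar w z)]
  have hbad0 : 0 ≤ bad w y z := by
    simp only [bad]; split_ifs <;> norm_num
  refine ⟨w, y, z, g w y z, hgs w y z, fun j h => hgn w y z j h, ?_, ?_⟩
  · have : 0 ≤ ℓ * bad w y z := mul_nonneg hℓ.le hbad0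
    linarith
  · let Q : (Fin ℓ → Ω) → ℝ := fun a => prodExp P (fun j => restrOp i (a j) (f j))
    have hQ0 : ∀ a, 0 ≤ Q a := fun a =>
      prodExp_nonneg P hP.1 _ fun j v => (hf _ _).1
    have hsplit : prodExp P f = ∑ a, P a * Q a := prodExp_split P hP f i
    have hterm : ∀ a, 0 ≤ P a * Q a := fun a => mul_nonneg (hP.1 a) (hQ0 a)
    rw [hsplit]
    -- factor out the step `jstar`
    have hfac : ∀ (u : Fin ℓ → ((Fin n → Ω) → ℝ)) (x : Fin ℓ → Fin n → Ω),
        ∏ j, u j (x j) = u jstar (x jstar) * ∏ j ∈ Finset.univ.erase jstar, u j (x j) :=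
      fun u x => (Finset.mul_prod_erase Finset.univ (fun j => u j (x j))
        (Finset.mem_univ jstar)).symm
    have hrest : ∀ (a : Ω) (x : Fin ℓ → Fin n → Ω),
        ∏ j ∈ Finset.univ.erase jstar, restrOp i (ins jstar w a j) (f j) (x j)
          = ∏ j ∈ Finset.univ.erase jstar, g w y z j (x j) := by
      intro a x
      refine Finset.prod_congr rfl fun j hj => ?_
      have hj' := Finset.ne_of_mem_erase hj
      rw [hgn w y z j hj', ins_ne jstar w a j hj']
    have hrest0 : ∀ (x : Fin ℓ → Fin n → Ω),
        0 ≤ ∏ j ∈ Finset.univ.erase jstar, g w y z j (x j) := fun x =>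
      Finset.prod_nonneg fun j _ => (hg01 w y z j (x j)).1
    have hQe : ∀ a, Q (ins jstar w a) = ∑ x : Fin ℓ → Fin n → Ω,
        (∏ k, P (fun j => x j k)) * (f jstar (Function.update (x jstar) i a) *
          ∏ j ∈ Finset.univ.erase jstar, g w y z j (x j)) := by
      intro a
      show prodExp P _ = _
      unfold prodExp
      refine Finset.sum_congr rfl fun x _ => ?_
      rw [hfac (fun j => restrOp i (ins jstar w a j) (f j)) x, hrest]
      simp only [ins_self, restrOp]
    have hge : prodExp P (g w y z) = ∑ x : Fin ℓ → Fin n → Ω,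
        (∏ k, P (fun j => x j k)) *
          (max (f jstar (Function.update (x jstar) i y)) (f jstar (Function.update (x jstar) i z)) *
          ∏ j ∈ Finset.univ.erase jstar, g w y z j (x j)) := by
      unfold prodExp
      refine Finset.sum_congr rfl fun x _ => ?_
      rw [hfac (g w y z) x, hgs]
      rfl
    by_cases hyz : y = z
    · have h1 : prodExp P (g w y z) = Q (ins jstar w y) := by
        rw [hge, hQe]
        refine Finset.sum_congr rfl fun x _ => ?_
        rw [← hyz, max_self]
      rw [h1]
      calc β * Q (ins jstar w y) ≤ P (ins jstar w y) * Q (ins jstar w y) :=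
            mul_le_mul_of_nonneg_right hgood.1 (hQ0 _)
        _ ≤ ∑ a, P a * Q a :=
            Finset.single_le_sum (f := fun a => P a * Q a) (fun a _ => hterm a)
              (Finset.mem_univ _)
    · have h1 : prodExp P (g w y z) ≤ Q (ins jstar w y) + Q (ins jstar w z) := by
        rw [hge, hQe, hQe, ← Finset.sum_add_distrib]
        refine Finset.sum_le_sum fun x _ => ?_
        rw [← mul_add, ← add_mul]
        refine mul_le_mul_of_nonneg_left (mul_le_mul_of_nonneg_right ?_ (hrest0 x))
          (Finset.prod_nonneg fun _ _ => hP.1 _)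
        exact max_le_add_of_nonneg (hf _ _).1 (hf _ _).1
      have hne : ins jstar w y ≠ ins jstar w z := by
        intro h
        have := congrFun h jstar
        rw [ins_self, ins_self] at this
        exact hyz this
      calc β * prodExp P (g w y z) ≤ β * (Q (ins jstar w y) + Q (ins jstar w z)) :=
            mul_le_mul_of_nonneg_left h1 hβ0
        _ ≤ P (ins jstar w y) * Q (ins jstar w y) + P (ins jstar w z) * Q (ins jstar w z) := by
            rw [mul_add]
            exact add_le_add (mul_le_mul_of_nonneg_right hgood.1 (hQ0 _))
              (mul_le_mul_of_nonneg_right hgood.2 (hQ0 _))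
        _ = ∑ a ∈ {ins jstar w y, ins jstar w z}, P a * Q a := by
            rw [Finset.sum_pair hne]
        _ ≤ ∑ a, P a * Q a :=
            Finset.sum_le_sum_of_subset_of_nonneg (Finset.subset_univ _)
              (fun a _ _ => hterm a)

end SameSetHitting
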